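/- arXiv:1101.5537 — 2 statements merged into one kernel-verified Lean document; each statement's English description precedes it below -/
import Mathlib

section
/- (Geometric form of Lemma 2.) Let n ≥ 3, let p : ZMod n → ℝ² be the vertices of the regular n-gon, p k = (cos(2πk/n), sin(2πk/n)), and let f : ZMod n → Fin 3 be a proper coloring of the cycle (f i ≠ f (i + 1) for all i) that is surjective onto Fin 3. Then there exists a simplicial complex K in ℝ² (in the sense of Mathlib's Geometry.SimplicialComplex) such that: the vertex set of K is exactly {p k : k ∈ ZMod n}; the underlying space of K equals the convex hull of {p k : k ∈ ZMod n}; for each i ∈ ZMod n the segment {p i, p (i+1)} is a face of K; and every 1-dimensional face {p a, p b} of K satisfies f a ≠ f b. -/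
open scoped Classical

/-- The vertices of the regular `n`-gon in the plane:
`p k = (cos (2πk/n), sin (2πk/n))` for `k : ZMod n`. -/
noncomputable def ngon (n : ℕ) (k : ZMod n) : ℝ × ℝ :=
  (Real.cos (2 * Real.pi * (k.val : ℝ) / (n : ℝ)),
   Real.sin (2 * Real.pi * (k.val : ℝ) / (n : ℝ)))

/-- Twice the signed area of the triangle `p q r`. -/
noncomputable def orientD (p q r : ℝ × ℝ) : ℝ :=
  (q.1 - p.1) * (r.2 - p.2) - (q.2 - p.2) * (r.1 - p.1)

lemma orientD_rot (p q r : ℝ × ℝ) : orientD q r p = orientD p q r := by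
  unfold orientD; ring

lemma orientD_affine (p q : ℝ × ℝ) {x y : ℝ × ℝ} {s t : ℝ} (h : s + t = 1) :
    orientD p q (s • x + t • y) = s * orientD p q x + t * orientD p q y := by
  obtain rfl : s = 1 - t := by linarith
  simp only [orientD, Prod.fst_add, Prod.snd_add, Prod.smul_fst, Prod.smul_snd, smul_eq_mul]
  ring

lemma orientD_nonneg_hull {p q : ℝ × ℝ} {V : Set (ℝ × ℝ)} (h : ∀ v ∈ V, 0 ≤ orientD p q v)
    {x : ℝ × ℝ} (hx : x ∈ convexHull ℝ V) : 0 ≤ orientD p q x := by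
  have hc : Convex ℝ {x | 0 ≤ orientD p q x} := by
    intro x hx y hy s t hs ht hst
    simp only [Set.mem_ofPred_eq] at *
    rw [orientD_affine p q hst]; positivity
  exact convexHull_min h hc hx

lemma indep_tri {a b c : ℝ × ℝ} (h : 0 < orientD a b c) :
    AffineIndependent ℝ ((↑) : (({a, b, c} : Finset (ℝ × ℝ))) → ℝ × ℝ) := by
  have h1 : AffineIndependent ℝ ![a, b, c] := by
    rw [affineIndependent_iff_not_collinear_set]
    intro hcol
    rw [collinear_iff_of_mem (p₀ := a) (by simp)] at hcol
    obtain ⟨v, hv⟩ := hcol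
    obtain ⟨r, hr⟩ := hv b (by simp)
    obtain ⟨s, hs⟩ := hv c (by simp)
    rw [hr, hs] at h
    simp [orientD] at h
    nlinarith
  have h2 := h1.range
  have h3 : Set.range ![a, b, c] = ((({a, b, c} : Finset (ℝ × ℝ))) : Set (ℝ × ℝ)) := by
    ext x
    simp only [Set.mem_range, Fin.exists_fin_succ, Finset.coe_insert, Finset.coe_singleton,
      Set.mem_insert_iff, Set.mem_singleton_iff]
    simp [eq_comm]
  rw [h3] at h2
  exact h2

lemma hull_insert {V : Set (ℝ × ℝ)} {a b c : ℝ × ℝ} (ha : a ∈ V) (hc : c ∈ V)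
    (hD : 0 < orientD a b c)
    (h1 : ∀ v ∈ V, 0 ≤ orientD a b v) (h2 : ∀ v ∈ V, 0 ≤ orientD b c v)
    (h3 : ∀ v ∈ V, 0 ≤ orientD a c v) :
    convexHull ℝ (insert b V) ⊆ convexHull ℝ V ∪ convexHull ℝ {a, b, c} := by
  intro x hx
  rw [convexHull_insert ⟨a, ha⟩, mem_convexJoin] at hx
  obtain ⟨b', hb', y, hy, hx⟩ := hx
  rw [Set.mem_singleton_iff] at hb'
  subst hb'
  obtain ⟨u, l, hu, hl, hul, rfl⟩ := hx
  have y1 := orientD_nonneg_hull h1 hy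
  have y2 := orientD_nonneg_hull h2 hy
  have y3 := orientD_nonneg_hull h3 hy
  set d := orientD a b' c with hd
  obtain ⟨s, hs⟩ : ∃ s, s = orientD b' c y / d := ⟨_, rfl⟩
  obtain ⟨t, ht⟩ : ∃ t, t = orientD a b' y / d := ⟨_, rfl⟩
  have hs0 : 0 ≤ s := hs ▸ by positivity
  have ht0 : 0 ≤ t := ht ▸ by positivity
  have hst : 1 ≤ s + t := by
    rw [hs, ht, ← add_div, le_div_iff₀ hD]
    have : orientD b' c y + orientD a b' y = d + orientD a c y := by
      simp only [hd, orientD]; ring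
    linarith
  have hyeq : y = (1 - s - t) • b' + s • a + t • c := by
    have e1 : s * d = orientD b' c y := by rw [hs]; field_simp
    have e2 : t * d = orientD a b' y := by rw [ht]; field_simp
    have hd0 : d ≠ 0 := hD.ne'
    ext
    · apply mul_left_cancel₀ hd0
      simp only [Prod.fst_add, Prod.smul_fst, smul_eq_mul]
      have : d * ((1 - s - t) * b'.1 + s * a.1 + t * c.1)
        = d * b'.1 + (s * d) * (a.1 - b'.1) + (t * d) * (c.1 - b'.1) := by ring
      rw [this, e1, e2, hd]; simp only [orientD]; ring
    · apply mul_left_cancel₀ hd0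
      simp only [Prod.snd_add, Prod.smul_snd, smul_eq_mul]
      have : d * ((1 - s - t) * b'.2 + s * a.2 + t * c.2)
        = d * b'.2 + (s * d) * (a.2 - b'.2) + (t * d) * (c.2 - b'.2) := by ring
      rw [this, e1, e2, hd]; simp only [orientD]; ring
  by_cases hcase : l * (s + t) ≤ 1
  · right
    have hcv := convex_convexHull ℝ ({a, b', c} : Set (ℝ × ℝ))
    have := hcv.sum_mem (t := Finset.univ) (w := ![1 - l * (s + t), l * s, l * t])
      (z := ![b', a, c]) (by
        intro i _
        fin_cases i
        · simpa using hcase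
        · simp; positivity
        · simp; positivity) (by simp [Fin.sum_univ_three]; ring)
      (by
        intro i _
        fin_cases i <;> exact subset_convexHull ℝ _ (by simp))
    convert this using 1
    simp only [Fin.sum_univ_three]
    rw [hyeq]
    obtain rfl : u = 1 - l := by linarith
    ext <;> simp <;> ring
  · left
    push Not at hcase
    have hst0 : 0 < s + t := by linarith
    have hcv := convex_convexHull ℝ V
    have hz : (s / (s + t)) • a + (t / (s + t)) • c ∈ convexHull ℝ V :=
      hcv (subset_convexHull ℝ _ ha) (subset_convexHull ℝ _ hc) (by positivity) (by positivity)
        (by field_simp)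
    rcases eq_or_lt_of_le hst with h | h
    · exfalso
      rw [← h] at hcase
      linarith
    have hm : 0 < s + t - 1 := by linarith
    obtain rfl : u = 1 - l := by linarith
    have := hcv hz hy (a := (1 - l) * (s + t) / (s + t - 1)) (b := (l * (s + t) - 1) / (s + t - 1))
      (by positivity) (div_nonneg (by linarith) hm.le) (by field_simp; ring)
    convert this using 1
    have hm0 : s + t - 1 ≠ 0 := hm.ne'
    rw [hyeq]
    ext <;> simp <;> field_simp <;> ring

lemma glue (K : Geometry.SimplicialComplex ℝ (ℝ × ℝ)) (V : Set (ℝ × ℝ)) (a b c : ℝ × ℝ)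
    (hK : K.vertices = V) (hs : K.space = convexHull ℝ V)
    (hac : ({a, c} : Finset (ℝ × ℝ)) ∈ K.faces) (hD : 0 < orientD a b c)
    (h1 : ∀ v ∈ V, 0 ≤ orientD a b v) (h2 : ∀ v ∈ V, 0 ≤ orientD b c v)
    (h3 : ∀ v ∈ V, 0 ≤ orientD a c v) :
    ∃ K' : Geometry.SimplicialComplex ℝ (ℝ × ℝ),
      K'.faces = K.faces ∪ {s | s ⊆ {a, b, c} ∧ s.Nonempty} ∧
      K'.vertices = insert b V ∧ K'.space = convexHull ℝ (insert b V) := by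
  have ha : a ∈ V := by
    rw [← hK]
    exact K.down_closed hac (by simp) (by simp)
  have hc : c ∈ V := by
    rw [← hK]
    exact K.down_closed hac (by simp) (by simp)
  have hind := indep_tri hD
  have key : ∀ s ∈ K.faces, ∀ t : Finset (ℝ × ℝ), t ⊆ {a, b, c} →
      convexHull ℝ (s : Set (ℝ × ℝ)) ∩ convexHull ℝ (t : Set (ℝ × ℝ)) ⊆
        convexHull ℝ ((s : Set (ℝ × ℝ)) ∩ t) := by
    rintro s hsK t ht x ⟨hxs, hxt⟩
    have hx0 : 0 ≤ orientD a c x := by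
      apply orientD_nonneg_hull h3
      rw [← hs]
      exact K.convexHull_subset_space hsK hxs
    have hxt' : x ∈ convexHull ℝ ((t.erase b : Finset (ℝ × ℝ)) : Set (ℝ × ℝ)) := by
      rw [Finset.convexHull_eq] at hxt
      obtain ⟨w, hw0, hw1, hwx⟩ := hxt
      rw [Finset.centerMass_eq_of_sum_1 _ _ hw1] at hwx
      simp only [id] at hwx
      by_cases hbt : b ∈ t
      · have hval : orientD a c x = ∑ y ∈ t, w y * orientD a c y := by
          have e1 : x.1 = ∑ y ∈ t, w y * y.1 := by rw [← hwx, Prod.fst_sum]; simp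
          have e2 : x.2 = ∑ y ∈ t, w y * y.2 := by rw [← hwx, Prod.snd_sum]; simp
          have : ∑ y ∈ t, w y * orientD a c y = (c.1 - a.1) * (∑ y ∈ t, w y * y.2)
              - (c.2 - a.2) * (∑ y ∈ t, w y * y.1)
              + ((c.2 - a.2) * a.1 - (c.1 - a.1) * a.2) * ∑ y ∈ t, w y := by
            rw [Finset.mul_sum, Finset.mul_sum, Finset.mul_sum, ← Finset.sum_sub_distrib,
              ← Finset.sum_add_distrib]
            refine Finset.sum_congr rfl fun y _ => ?_
            simp only [orientD]; ring
          rw [this, hw1, ← e1, ← e2]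
          simp only [orientD]; ring
        have hz : ∑ y ∈ t.erase b, w y * orientD a c y = 0 := by
          refine Finset.sum_eq_zero fun y hy => ?_
          have := ht (Finset.mem_of_mem_erase hy)
          have hyb := Finset.ne_of_mem_erase hy
          simp only [Finset.mem_insert, Finset.mem_singleton] at this
          rcases this with rfl | rfl | rfl
          · simp [orientD]
          · exact absurd rfl hyb
          · simp [orientD]; right; ring
        rw [← Finset.add_sum_erase _ _ hbt, hz, add_zero] at hval
        have hneg : orientD a c b = - orientD a b c := by simp only [orientD]; ring
        have hwb : w b = 0 := by
          have := hw0 b hbt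
          rw [hneg] at hval
          nlinarith
        rw [Finset.convexHull_eq]
        rw [← Finset.add_sum_erase _ _ hbt, hwb, zero_add] at hw1
        rw [← Finset.add_sum_erase _ _ hbt, hwb, zero_smul, zero_add] at hwx
        refine ⟨w, fun y hy => hw0 y (Finset.mem_of_mem_erase hy), hw1, ?_⟩
        rw [Finset.centerMass_eq_of_sum_1 _ _ hw1]
        simpa using hwx
      · rw [Finset.erase_eq_of_notMem hbt, Finset.convexHull_eq]
        refine ⟨w, hw0, hw1, ?_⟩
        rw [Finset.centerMass_eq_of_sum_1 _ _ hw1]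
        simpa using hwx
    have hne : (t.erase b).Nonempty := by
      have := (convexHull_nonempty_iff (𝕜 := ℝ)).1 ⟨x, hxt'⟩
      exact_mod_cast this
    have hface : t.erase b ∈ K.faces := by
      refine K.down_closed hac ?_ hne
      intro y hy
      have := ht (Finset.mem_of_mem_erase hy)
      have hyb := Finset.ne_of_mem_erase hy
      simp only [Finset.mem_insert, Finset.mem_singleton] at this ⊢
      tauto
    refine convexHull_mono ?_ (K.inter_subset_convexHull hsK hface ⟨hxs, hxt'⟩)
    exact Set.inter_subset_inter_right _ (by simpa using Set.diff_subset)
  let K' : Geometry.SimplicialComplex ℝ (ℝ × ℝ) :=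
    { faces := K.faces ∪ {s | s ⊆ {a, b, c} ∧ s.Nonempty}
      isRelLowerSet_faces := by
        rintro s (hs' | hs')
        · refine ⟨K.nonempty_of_mem_faces hs', fun t hts htn => ?_⟩
          exact Or.inl (K.down_closed hs' hts htn)
        · exact ⟨hs'.2, fun t hts htn => Or.inr ⟨Finset.Subset.trans hts hs'.1, htn⟩⟩
      indep := by
        rintro s (hs' | hs')
        · exact K.indep hs'
        · exact hind.mono (t := (({a, b, c} : Finset (ℝ × ℝ)) : Set (ℝ × ℝ)))
            (by exact_mod_cast hs'.1)
      inter_subset_convexHull := by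
        rintro s t (hs' | hs') (ht' | ht')
        · exact K.inter_subset_convexHull hs' ht'
        · exact key s hs' t ht'.1
        · rw [Set.inter_comm, Set.inter_comm (s : Set (ℝ × ℝ))]
          exact key t ht' s hs'.1
        · have := hind.convexHull_inter hs'.1 ht'.1
          rw [← this] }
  refine ⟨K', rfl, ?_, ?_⟩
  · ext x
    rw [Geometry.SimplicialComplex.mem_vertices]
    change _ ∈ K.faces ∪ _ ↔ _
    rw [Set.mem_union, ← Geometry.SimplicialComplex.mem_vertices, hK]
    simp only [Set.mem_ofPred_eq, Finset.singleton_subset_iff, Finset.mem_insert,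
      Finset.mem_singleton, Finset.singleton_nonempty, and_true, Set.mem_insert_iff]
    constructor
    · rintro (h | rfl | rfl | rfl) <;> tauto
    · tauto
  · apply Set.Subset.antisymm
    · intro x hx
      rw [Geometry.SimplicialComplex.mem_space_iff] at hx
      obtain ⟨s, (hs' | hs'), hxs⟩ := hx
      · have : x ∈ K.space := K.convexHull_subset_space hs' hxs
        rw [hs] at this
        exact convexHull_mono (Set.subset_insert _ _) this
      · refine convexHull_mono ?_ hxs
        intro y hy
        have := hs'.1 hy
        simp only [Finset.mem_insert, Finset.mem_singleton] at this
        rcases this with rfl | rfl | rfl <;> simp [ha, hc]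
    · intro x hx
      rcases hull_insert ha hc hD h1 h2 h3 hx with h | h
      · rw [← hs, Geometry.SimplicialComplex.mem_space_iff] at h
        obtain ⟨s, hs', hxs⟩ := h
        exact Geometry.SimplicialComplex.mem_space_iff.2 ⟨s, Or.inl hs', hxs⟩
      · refine Geometry.SimplicialComplex.mem_space_iff.2
          ⟨{a, b, c}, Or.inr ⟨Finset.Subset.refl _, by simp⟩, by simpa using h⟩

/-- The complex of all faces of a triangle. -/
lemma tri_complex {a b c : ℝ × ℝ} (hD : 0 < orientD a b c) :
    ∃ K : Geometry.SimplicialComplex ℝ (ℝ × ℝ),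
      K.faces = {s | s ⊆ {a, b, c} ∧ s.Nonempty} ∧
      K.vertices = {a, b, c} ∧ K.space = convexHull ℝ {a, b, c} := by
  have hind := indep_tri hD
  let K' : Geometry.SimplicialComplex ℝ (ℝ × ℝ) :=
    { faces := {s | s ⊆ {a, b, c} ∧ s.Nonempty}
      isRelLowerSet_faces := by
        intro s hs'
        exact ⟨hs'.2, fun t hts htn => ⟨Finset.Subset.trans hts hs'.1, htn⟩⟩
      indep := by
        intro s hs'
        exact hind.mono (t := (({a, b, c} : Finset (ℝ × ℝ)) : Set (ℝ × ℝ)))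
            (by exact_mod_cast hs'.1)
      inter_subset_convexHull := by
        intro s t hs' ht'
        have := hind.convexHull_inter hs'.1 ht'.1
        rw [← this] }
  refine ⟨K', rfl, ?_, ?_⟩
  · ext x
    rw [Geometry.SimplicialComplex.mem_vertices]
    change _ ∈ {s : Finset (ℝ × ℝ) | s ⊆ {a, b, c} ∧ s.Nonempty} ↔ _
    simp
  · apply Set.Subset.antisymm
    · intro x hx
      rw [Geometry.SimplicialComplex.mem_space_iff] at hx
      obtain ⟨s, hs', hxs⟩ := hx
      refine convexHull_mono ?_ hxs
      intro y hy
      have := hs'.1 hy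
      simpa using this
    · intro x hx
      refine Geometry.SimplicialComplex.mem_space_iff.2
          ⟨{a, b, c}, ⟨Finset.Subset.refl _, by simp⟩, by simpa using hx⟩

/-- Cyclic successor relation on `{0, …, m-1}`. -/
def CycSucc (m i j : ℕ) : Prop := (j = i + 1 ∧ j < m) ∨ (i + 1 = m ∧ j = 0)

lemma exists_ear (m : ℕ) (hm : 4 ≤ m) (g : ℕ → Fin 3)
    (hg : ∀ i j, CycSucc m i j → g i ≠ g j) (hs : ∀ c, ∃ i < m, g i = c) :
    ∃ a b c, CycSucc m a b ∧ CycSucc m b c ∧ g a ≠ g c ∧ ∃ l < m, l ≠ b ∧ g l = g b := by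
  by_contra hno
  push Not at hno
  have h3 : ∃ i, i + 2 < m ∧ g i ≠ g (i + 2) := by
    by_contra h
    push Not at h
    have hall : ∀ k, k < m → g k = g 0 ∨ g k = g 1 := by
      intro k
      induction k using Nat.strong_induction_on with
      | _ k ih =>
        intro hk
        match k with
        | 0 => simp
        | 1 => simp
        | k + 2 =>
          rw [← h k hk]
          exact ih k (by omega) (by omega)
    obtain ⟨c, hc0, hc1⟩ : ∃ c : Fin 3, c ≠ g 0 ∧ c ≠ g 1 := by
      generalize g 0 = x
      generalize g 1 = y
      revert x y; decide
    obtain ⟨i, hi, rfl⟩ := hs c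
    rcases hall i hi with h | h <;> contradiction
  obtain ⟨i, hi, hne⟩ := h3
  have e01 : g i ≠ g (i + 1) := hg _ _ (by unfold CycSucc; omega)
  have e12 : g (i + 1) ≠ g (i + 2) := hg _ _ (by unfold CycSucc; omega)
  have u1 := hno i (i + 1) (i + 2) (by unfold CycSucc; omega) (by unfold CycSucc; omega) hne
  have u2 : ∀ l < m, l ≠ i + 2 → g l ≠ g (i + 2) := by
    obtain ⟨c, hc, hcm, hci⟩ : ∃ c, CycSucc m (i + 2) c ∧ c < m ∧ c ≠ i + 1 := by
      by_cases h : i + 3 = m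
      · exact ⟨0, by unfold CycSucc; omega, by omega, by omega⟩
      · exact ⟨i + 3, by unfold CycSucc; omega, by omega, by omega⟩
    exact hno (i + 1) (i + 2) c (by unfold CycSucc; omega) hc (u1 c hcm hci).symm
  have u0 : ∀ l < m, l ≠ i → g l ≠ g i := by
    obtain ⟨c, hc, hcm, hci⟩ : ∃ c, CycSucc m c i ∧ c < m ∧ c ≠ i + 1 := by
      by_cases h : i = 0
      · exact ⟨m - 1, by unfold CycSucc; omega, by omega, by omega⟩
      · exact ⟨i - 1, by unfold CycSucc; omega, by omega, by omega⟩
    exact hno c i (i + 1) hc (by unfold CycSucc; omega) (u1 c hcm hci)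
  obtain ⟨l, hl, l0, l1, l2⟩ : ∃ l < m, l ≠ i ∧ l ≠ i + 1 ∧ l ≠ i + 2 := by
    by_cases h : i = 0
    · exact ⟨3, by omega, by omega, by omega, by omega⟩
    · exact ⟨0, by omega, by omega, by omega, by omega⟩
  have a0 := u0 l hl l0
  have a1 := u1 l hl l1
  have a2 := u2 l hl l2
  revert a0 a1 a2 e01 e12 hne
  generalize g l = x
  generalize g i = y
  generalize g (i + 1) = z
  generalize g (i + 2) = w
  intro e01 e12 hne a0 a1 a2
  omega

lemma orientD_cyc {m : ℕ} {q : ℕ → ℝ × ℝ}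
    (hq : ∀ i j k, i < j → j < k → k < m → 0 < orientD (q i) (q j) (q k)) {i j k : ℕ}
    (hi : i < m) (hj : j < m) (hk : k < m)
    (h : (i < j ∧ j < k) ∨ (j < k ∧ k < i) ∨ (k < i ∧ i < j)) :
    0 < orientD (q i) (q j) (q k) := by
  rcases h with h | h | h
  · exact hq _ _ _ h.1 h.2 hk
  · rw [← orientD_rot]; exact hq _ _ _ h.1 h.2 hi
  · rw [← orientD_rot, ← orientD_rot]; exact hq _ _ _ h.1 h.2 hj

lemma orientD_self_left (p q : ℝ × ℝ) : orientD p q p = 0 := by unfold orientD; ring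
lemma orientD_self_right (p q : ℝ × ℝ) : orientD p q q = 0 := by unfold orientD; ring

lemma main_induction (G : ℝ × ℝ → Fin 3) (m : ℕ) : ∀ (_ : 3 ≤ m) (q : ℕ → ℝ × ℝ)
    (_ : ∀ i j k, i < j → j < k → k < m → 0 < orientD (q i) (q j) (q k))
    (_ : ∀ i j, CycSucc m i j → G (q i) ≠ G (q j)) (_ : ∀ c, ∃ i < m, G (q i) = c),
    ∃ K : Geometry.SimplicialComplex ℝ (ℝ × ℝ),
      K.vertices = q '' Set.Iio m ∧ K.space = convexHull ℝ (q '' Set.Iio m) ∧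
      (∀ i j, CycSucc m i j → ({q i, q j} : Finset (ℝ × ℝ)) ∈ K.faces) ∧
      (∀ x y, x ≠ y → ({x, y} : Finset (ℝ × ℝ)) ∈ K.faces → G x ≠ G y) := by
  induction m with
  | zero => intro h; omega
  | succ m ih =>
  intro hm q hq hg hs
  by_cases hm3 : m = 2
  · subst hm3
    have hD := hq 0 1 2 (by omega) (by omega) (by omega)
    obtain ⟨K, hK, hv, hsp⟩ := tri_complex hD
    have himg : q '' Set.Iio (2 + 1) = {q 0, q 1, q 2} := by
      ext x
      simp only [Set.mem_image, Set.mem_Iio, Set.mem_insert_iff, Set.mem_singleton_iff]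
      constructor
      · rintro ⟨i, hi, rfl⟩
        interval_cases i <;> simp
      · rintro (rfl | rfl | rfl)
        · exact ⟨0, by omega, rfl⟩
        · exact ⟨1, by omega, rfl⟩
        · exact ⟨2, by omega, rfl⟩
    have g01 := hg 0 1 (by unfold CycSucc; omega)
    have g12 := hg 1 2 (by unfold CycSucc; omega)
    have g20 := hg 2 0 (by unfold CycSucc; omega)
    refine ⟨K, by rw [hv, himg], by rw [hsp, himg], ?_, ?_⟩
    · intro i j hij
      rw [hK]
      refine ⟨?_, by simp⟩
      have hi : i < 3 := by unfold CycSucc at hij; omega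
      have hj : j < 3 := by unfold CycSucc at hij; omega
      have : ∀ i, i < 3 → q i ∈ ({q 0, q 1, q 2} : Finset (ℝ × ℝ)) := by
        intro i hi
        interval_cases i <;> simp
      intro x hx
      simp only [Finset.mem_insert, Finset.mem_singleton] at hx
      rcases hx with rfl | rfl
      · exact this _ hi
      · exact this _ hj
    · intro x y hxy hf
      rw [hK] at hf
      have hx := hf.1 (Finset.mem_insert_self x _)
      have hy := hf.1 (Finset.mem_insert_of_mem (Finset.mem_singleton_self y))
      simp only [Finset.mem_insert, Finset.mem_singleton] at hx hy
      rcases hx with rfl | rfl | rfl <;> rcases hy with rfl | rfl | rfl <;>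
        first | exact absurd rfl hxy | assumption | (apply Ne.symm; assumption)
  · obtain ⟨a, b, c, hab, hbc, hac, l, hl, hlb, hlg⟩ :=
      exists_ear (m + 1) (by omega) (fun i => G (q i)) hg hs
    obtain ⟨sk, hsk⟩ : ∃ sk : ℕ → ℕ, ∀ x, sk x = if x < b then x else x + 1 := ⟨_, fun _ => rfl⟩
    have hskb : ∀ x, sk x ≠ b := by intro x; rw [hsk]; split_ifs <;> omega
    have hskm : ∀ x, x < m → sk x < m + 1 := by intro x hx; rw [hsk]; split_ifs <;> omega
    have hsurj : ∀ x, x < m + 1 → x ≠ b → ∃ y < m, sk y = x := by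
      intro x hx hxb
      by_cases h : x < b
      · exact ⟨x, by unfold CycSucc at hab; omega, by rw [hsk, if_pos h]⟩
      · exact ⟨x - 1, by omega, by rw [hsk, if_neg (by omega)]; omega⟩
    have hcyc : ∀ x y, CycSucc m x y → CycSucc (m + 1) (sk x) (sk y) ∨ (sk x = a ∧ sk y = c) := by
      intro x y h
      rw [hsk, hsk]
      unfold CycSucc at *
      split_ifs <;> omega
    have hcyc' : ∀ x y, CycSucc (m + 1) (sk x) (sk y) → x < m → y < m → CycSucc m x y := by
      intro x y
      rw [hsk, hsk]
      unfold CycSucc at *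
      split_ifs <;> intro h1 h2 h3 <;> rcases h1 with ⟨h4, h5⟩ | ⟨h4, h5⟩ <;> first | omega | exact h5.elim
    have hcycac : ∀ x y, sk x = a → sk y = c → CycSucc m x y := by
      intro x y
      rw [hsk, hsk]
      unfold CycSucc at *
      split_ifs <;> intro h1 h2 <;> omega
    have hbm : b < m + 1 := by unfold CycSucc at hab; omega
    have ham : a < m + 1 := by unfold CycSucc at hab; omega
    have hcm : c < m + 1 := by unfold CycSucc at hbc; omega
    have hab' : a ≠ b := by unfold CycSucc at hab; omega
    have hcb' : c ≠ b := by unfold CycSucc at hbc; omega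
    obtain ⟨K, hv, hsp, hedge, hcol⟩ := ih (by omega) (fun x => q (sk x))
      (by
        intro i j k hij hjk hk
        refine hq _ _ _ ?_ ?_ (hskm _ hk) <;> rw [hsk, hsk] <;> split_ifs <;> omega)
      (by
        intro i j hij
        rcases hcyc i j hij with h | ⟨h1, h2⟩
        · exact hg _ _ h
        · simp only [h1, h2]; exact hac)
      (by
        intro col
        obtain ⟨i, hi, hic⟩ := hs col
        by_cases hib : i = b
        · obtain ⟨y, hy, hyl⟩ := hsurj l hl hlb
          exact ⟨y, hy, by rw [hyl, hlg, ← hib, hic]⟩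
        · obtain ⟨y, hy, hyl⟩ := hsurj i hi hib
          exact ⟨y, hy, by rw [hyl, hic]⟩)
    have hgab := hg a b hab
    have hgbc := hg b c hbc
    obtain ⟨a', ha', haa⟩ := hsurj a ham hab'
    obtain ⟨c', hc', hcc⟩ := hsurj c hcm hcb'
    have hfac : ({q a, q c} : Finset (ℝ × ℝ)) ∈ K.faces := by
      rw [← haa, ← hcc]
      exact hedge a' c' (hcycac _ _ haa hcc)
    have hV : ∀ P : ℝ × ℝ → Prop, (∀ x < m + 1, x ≠ b → P (q x)) →
        ∀ v ∈ (fun x => q (sk x)) '' Set.Iio m, P v := by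
      rintro P hP _ ⟨x, hx, rfl⟩
      exact hP _ (hskm x hx) (hskb x)
    obtain ⟨K', hf', hv', hs'⟩ := glue K _ (q a) (q b) (q c) hv hsp hfac
      (orientD_cyc hq ham hbm hcm (by unfold CycSucc at *; omega))
      (hV _ (by
        intro x hx hxb
        by_cases hxa : x = a
        · rw [hxa, orientD_self_left]
        · exact (orientD_cyc hq ham hbm hx (by unfold CycSucc at *; omega)).le))
      (hV _ (by
        intro x hx hxb
        by_cases hxa : x = c
        · rw [hxa, orientD_self_right]
        · exact (orientD_cyc hq hbm hcm hx (by unfold CycSucc at *; omega)).le))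
      (hV _ (by
        intro x hx hxb
        by_cases hxa : x = a
        · rw [hxa, orientD_self_left]
        by_cases hxc : x = c
        · rw [hxc, orientD_self_right]
        · exact (orientD_cyc hq ham hcm hx (by unfold CycSucc at *; omega)).le))
    have himg : insert (q b) ((fun x => q (sk x)) '' Set.Iio m) = q '' Set.Iio (m + 1) := by
      ext x
      simp only [Set.mem_insert_iff, Set.mem_image, Set.mem_Iio]
      constructor
      · rintro (rfl | ⟨y, hy, rfl⟩)
        · exact ⟨b, hbm, rfl⟩
        · exact ⟨sk y, hskm y hy, rfl⟩
      · rintro ⟨y, hy, rfl⟩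
        by_cases hyb : y = b
        · left; rw [hyb]
        · obtain ⟨z, hz, rfl⟩ := hsurj y hy hyb
          exact Or.inr ⟨z, hz, rfl⟩
    rw [himg] at hv' hs'
    refine ⟨K', hv', hs', ?_, ?_⟩
    · intro i j hij
      rw [hf']
      by_cases hib : i = b
      · right
        have : j = c := by unfold CycSucc at *; omega
        subst hib this
        exact ⟨Finset.subset_insert _ _, by simp⟩
      by_cases hjb : j = b
      · right
        have : i = a := by unfold CycSucc at *; omega
        subst hjb this
        refine ⟨?_, by simp⟩
        intro x hx
        simp only [Finset.mem_insert, Finset.mem_singleton] at hx ⊢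
        tauto
      · left
        obtain ⟨i', hi', rfl⟩ := hsurj i (by unfold CycSucc at hij; omega) hib
        obtain ⟨j', hj', rfl⟩ := hsurj j (by unfold CycSucc at hij; omega) hjb
        exact hedge i' j' (hcyc' _ _ hij hi' hj')
    · intro x y hxy hf
      rw [hf'] at hf
      rcases hf with hf | hf
      · exact hcol x y hxy hf
      · have hx := hf.1 (Finset.mem_insert_self x _)
        have hy := hf.1 (Finset.mem_insert_of_mem (Finset.mem_singleton_self y))
        simp only [Finset.mem_insert, Finset.mem_singleton] at hx hy
        rcases hx with rfl | rfl | rfl <;> rcases hy with rfl | rfl | rfl <;>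
          first | exact absurd rfl hxy | assumption | (apply Ne.symm; assumption)

lemma orientD_circle (x u v : ℝ) :
    orientD (Real.cos x, Real.sin x) (Real.cos (x + 2 * u), Real.sin (x + 2 * u))
      (Real.cos (x + 2 * u + 2 * v), Real.sin (x + 2 * u + 2 * v)) =
    4 * Real.sin u * Real.sin v * Real.sin (u + v) := by
  have h1 := Real.sin_sq_add_cos_sq x
  have h2 := Real.sin_sq_add_cos_sq u
  have h3 := Real.sin_sq_add_cos_sq v
  have key : orientD (Real.cos x, Real.sin x) (Real.cos (x + 2 * u), Real.sin (x + 2 * u))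
      (Real.cos (x + 2 * u + 2 * v), Real.sin (x + 2 * u + 2 * v)) =
      Real.sin (2 * u) + Real.sin (2 * v) - Real.sin (2 * u + 2 * v) := by
    have e1 : Real.sin (2 * u) = Real.sin ((x + 2 * u) - x) := by ring_nf
    have e2 : Real.sin (2 * v) = Real.sin ((x + 2 * u + 2 * v) - (x + 2 * u)) := by ring_nf
    have e3 : Real.sin (2 * u + 2 * v) = Real.sin ((x + 2 * u + 2 * v) - x) := by ring_nf
    rw [e1, e2, e3, Real.sin_sub, Real.sin_sub, Real.sin_sub]
    simp only [orientD]; ring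
  rw [key, Real.sin_add, Real.sin_add, Real.sin_two_mul, Real.sin_two_mul, Real.cos_two_mul,
    Real.cos_two_mul]
  have a2 : Real.cos u ^ 2 = 1 - Real.sin u ^ 2 := by linarith
  have a3 : Real.cos v ^ 2 = 1 - Real.sin v ^ 2 := by linarith
  rw [a2, a3]; ring

lemma ngon_orient (n : ℕ) (hn : 3 ≤ n) (i j k : ℕ) (hij : i < j) (hjk : j < k) (hk : k < n) :
    0 < orientD (ngon n (i : ZMod n)) (ngon n (j : ZMod n)) (ngon n (k : ZMod n)) := by
  simp only [ngon]
  rw [ZMod.val_natCast_of_lt (by omega : i < n), ZMod.val_natCast_of_lt (by omega : j < n),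
    ZMod.val_natCast_of_lt hk]
  have hn0 : (0 : ℝ) < n := by exact_mod_cast (by omega : 0 < n)
  have h1 : (i : ℝ) < j := by exact_mod_cast hij
  have h2 : (j : ℝ) < k := by exact_mod_cast hjk
  have h3 : (k : ℝ) < n := by exact_mod_cast hk
  have h0 : (0 : ℝ) ≤ i := by positivity
  have hp := Real.pi_pos
  have hsin : ∀ t : ℝ, 0 < t → t < n → 0 < Real.sin (Real.pi * t / n) := by
    intro t ht0 htn
    apply Real.sin_pos_of_pos_of_lt_pi
    · positivity
    · rw [div_lt_iff₀ hn0]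
      exact mul_lt_mul_of_pos_left htn hp
  have := orientD_circle (2 * Real.pi * i / n) (Real.pi * (j - i) / n) (Real.pi * (k - j) / n)
  have e1 : 2 * Real.pi * i / n + 2 * (Real.pi * (j - i) / n) = 2 * Real.pi * j / n := by ring
  have e2 : 2 * Real.pi * j / n + 2 * (Real.pi * (k - j) / n) = 2 * Real.pi * k / n := by ring
  have e3 : Real.pi * (j - i) / n + Real.pi * (k - j) / n = Real.pi * ((k : ℝ) - i) / n := by ring
  rw [e1, e2, e3] at this
  rw [this]
  have s1 := hsin (j - i) (by linarith) (by linarith)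
  have s2 := hsin (k - j) (by linarith) (by linarith)
  have s3 := hsin (k - i) (by linarith) (by linarith)
  positivity

lemma ngon_injective (n : ℕ) (hn : 3 ≤ n) : Function.Injective (ngon n) := by
  have : NeZero n := ⟨by omega⟩
  have key : ∀ i j : ℕ, i < j → j < n → ngon n (i : ZMod n) ≠ ngon n (j : ZMod n) := by
    intro i j hij hj he
    obtain ⟨k, hk, hki, hkj⟩ : ∃ k < n, k ≠ i ∧ k ≠ j := by
      by_cases h0 : i = 0
      · by_cases h1 : j = 1
        · exact ⟨2, by omega, by omega, by omega⟩
        · exact ⟨1, by omega, by omega, by omega⟩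
      · exact ⟨0, by omega, by omega, by omega⟩
    have hz : ∀ p r : ℝ × ℝ, orientD p p r = 0 := by intro p r; unfold orientD; ring
    rcases lt_trichotomy k i with h | h | h
    · have := orientD_cyc (q := fun x : ℕ => ngon n (x : ZMod n)) (ngon_orient n hn)
        (by omega : i < n) hj hk (by omega)
      simp only [he, hz, lt_irrefl] at this
    · exact hki h
    · rcases lt_trichotomy k j with h' | h' | h'
      · have := orientD_cyc (q := fun x : ℕ => ngon n (x : ZMod n)) (ngon_orient n hn)
          hj (by omega : i < n) hk (by omega)
        simp only [he, hz, lt_irrefl] at this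
      · exact hkj h'
      · have := orientD_cyc (q := fun x : ℕ => ngon n (x : ZMod n)) (ngon_orient n hn)
          (by omega : i < n) hj hk (by omega)
        simp only [he, hz, lt_irrefl] at this
  intro x y hxy
  have hx := ZMod.natCast_zmod_val x
  have hy := ZMod.natCast_zmod_val y
  rcases lt_trichotomy x.val y.val with h | h | h
  · have := key _ _ h (ZMod.val_lt y)
    rw [hx, hy] at this; exact absurd hxy this
  · rw [← hx, ← hy, h]
  · have := key _ _ h (ZMod.val_lt x)
    rw [hx, hy] at this; exact absurd hxy.symm this

theorem stmt_7 (n : ℕ) (hn : 3 ≤ n) (f : ZMod n → Fin 3)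
    (hf : ∀ i, f i ≠ f (i + 1)) (hsurj : Function.Surjective f) :
    ∃ K : Geometry.SimplicialComplex ℝ (ℝ × ℝ),
      K.vertices = Set.range (ngon n) ∧
      K.space = convexHull ℝ (Set.range (ngon n)) ∧
      (∀ i : ZMod n, ({ngon n i, ngon n (i + 1)} : Finset (ℝ × ℝ)) ∈ K.faces) ∧
      (∀ a b : ZMod n, a ≠ b →
        ({ngon n a, ngon n b} : Finset (ℝ × ℝ)) ∈ K.faces → f a ≠ f b) := by
  have : NeZero n := ⟨by omega⟩
  have hinj := ngon_injective n hn
  have hG : ∀ x, f (Function.invFun (ngon n) (ngon n x)) = f x := by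
    intro x
    rw [Function.leftInverse_invFun hinj x]
  have hcast : ∀ i j, CycSucc n i j → (j : ZMod n) = (i : ZMod n) + 1 := by
    rintro i j (⟨rfl, _⟩ | ⟨h, rfl⟩)
    · push_cast; rfl
    · have : ((i + 1 : ℕ) : ZMod n) = 0 := by rw [h]; simp
      push_cast at this ⊢
      exact this.symm
  obtain ⟨K, hv, hs, he, hc⟩ := main_induction (fun x => f (Function.invFun (ngon n) x)) n hn
    (fun k => ngon n (k : ZMod n)) (ngon_orient n hn)
    (by
      intro i j hij
      simp only [hG, hcast i j hij]
      exact hf _)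
    (by
      intro c
      obtain ⟨x, rfl⟩ := hsurj c
      refine ⟨x.val, ZMod.val_lt x, ?_⟩
      simp only [ZMod.natCast_zmod_val, hG])
  have himg : (fun k : ℕ => ngon n (k : ZMod n)) '' Set.Iio n = Set.range (ngon n) := by
    ext p
    constructor
    · rintro ⟨k, _, rfl⟩
      exact ⟨_, rfl⟩
    · rintro ⟨x, rfl⟩
      exact ⟨x.val, ZMod.val_lt x, by simp only [ZMod.natCast_zmod_val]⟩
  rw [himg] at hv hs
  refine ⟨K, hv, hs, ?_, ?_⟩
  · intro i
    have hi := ZMod.val_lt i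
    obtain ⟨j, hj⟩ : ∃ j, CycSucc n i.val j := by
      by_cases h : i.val + 1 = n
      · exact ⟨0, Or.inr ⟨h, rfl⟩⟩
      · exact ⟨i.val + 1, Or.inl ⟨rfl, by omega⟩⟩
    have := he _ _ hj
    simp only [hcast _ _ hj, ZMod.natCast_zmod_val] at this
    exact this
  · intro a b hab hface
    have := hc _ _ (hinj.ne hab) hface
    simpa only [hG] using this
end

section
/- Let n ≥ 3, let p : ZMod n → ℝ² be the vertices of the regular n-gon, p k = (cos(2πk/n), sin(2πk/n)), and let K be a simplicial complex in ℝ² (in the sense of Mathlib's Geometry.SimplicialComplex) whose vertex set is exactly {p k : k ∈ ZMod n} and whose underlying space equals the convex hull of {p k : k ∈ ZMod n}. Then K has exactly n − 2 two-dimensional faces and exactly n − 3 one-dimensional faces that are not of the form {p i, p (i+1)} (i.e. exactly n − 3 diagonals). -/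
open scoped Classical

open scoped Topology
open Filter

/-- Vertices indexed by natural numbers. -/
noncomputable def pt (n : ℕ) (k : ℕ) : ℝ × ℝ :=
  (Real.cos (2 * Real.pi * (k : ℝ) / (n : ℝ)),
   Real.sin (2 * Real.pi * (k : ℝ) / (n : ℝ)))

/-- Orientation determinant. -/
def orient (a b c : ℝ × ℝ) : ℝ :=
  (b.1 - a.1) * (c.2 - a.2) - (b.2 - a.2) * (c.1 - a.1)

lemma orient_rot (a b c : ℝ × ℝ) : orient b c a = orient a b c := by
  unfold orient; ring

lemma orient_swap (a b c : ℝ × ℝ) : orient b a c = - orient a b c := by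
  unfold orient; ring

lemma orient_left (a b : ℝ × ℝ) : orient a b a = 0 := by
  unfold orient; ring

lemma orient_right (a b : ℝ × ℝ) : orient a b b = 0 := by
  unfold orient; ring

lemma orient_line (a b M X : ℝ × ℝ) (e : ℝ) :
    orient a b (AffineMap.lineMap M X e) = (1 - e) * orient a b M + e * orient a b X := by
  simp only [orient, AffineMap.lineMap_apply, vsub_eq_sub, vadd_eq_add, Prod.fst_add, Prod.snd_add,
    Prod.smul_fst, Prod.smul_snd, Prod.fst_sub, Prod.snd_sub, smul_eq_mul]
  ring

lemma orient_mid (a b M X : ℝ × ℝ) :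
    orient a b (midpoint ℝ M X) = (orient a b M + orient a b X) / 2 := by
  rw [midpoint, orient_line]; norm_num; ring

lemma orient_trig (x y z : ℝ) :
    orient (Real.cos (2 * x), Real.sin (2 * x)) (Real.cos (2 * y), Real.sin (2 * y))
      (Real.cos (2 * z), Real.sin (2 * z))
      = 4 * Real.sin (y - x) * Real.sin (z - y) * Real.sin (z - x) := by
  simp only [orient, Real.cos_two_mul', Real.sin_two_mul, Real.sin_sub]
  have hx := Real.sin_sq_add_cos_sq x
  have hy := Real.sin_sq_add_cos_sq y
  have hz := Real.sin_sq_add_cos_sq z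
  have hx' : Real.sin x ^ 2 = 1 - Real.cos x ^ 2 := by linarith
  have hy' : Real.sin y ^ 2 = 1 - Real.cos y ^ 2 := by linarith
  have hz' : Real.sin z ^ 2 = 1 - Real.cos z ^ 2 := by linarith
  generalize Real.sin x = sx at *
  generalize Real.sin y = sy at *
  generalize Real.sin z = sz at *
  generalize Real.cos x = cx at *
  generalize Real.cos y = cy at *
  generalize Real.cos z = cz at *
  grind

lemma orient_pos {n i j k : ℕ} (hij : i < j) (hjk : j < k) (hk : k < n) :
    0 < orient (pt n i) (pt n j) (pt n k) := by
  have hn : (0 : ℝ) < n := by exact_mod_cast (by omega : 0 < n)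
  have e : ∀ m : ℕ, pt n m = (Real.cos (2 * (Real.pi * m / n)), Real.sin (2 * (Real.pi * m / n))) := by
    intro m; unfold pt; congr 2 <;> ring
  rw [e, e, e, orient_trig]
  have key : ∀ a b : ℕ, a < b → b < n → 0 < Real.sin (Real.pi * b / n - Real.pi * a / n) := by
    intro a b hab hb
    have h1 : (a : ℝ) < b := by exact_mod_cast hab
    have h2 : (b : ℝ) < n := by exact_mod_cast hb
    have h3 : (0 : ℝ) ≤ a := Nat.cast_nonneg a
    have : Real.pi * b / n - Real.pi * a / n = Real.pi * ((b - a) / n) := by ring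
    rw [this]
    apply Real.sin_pos_of_pos_of_lt_pi
    · have : 0 < (b : ℝ) - a := by linarith
      have := Real.pi_pos
      positivity
    · have : ((b : ℝ) - a) / n < 1 := by rw [div_lt_one hn]; linarith
      nlinarith [Real.pi_pos]
  have := key i j hij (by omega)
  have := key j k hjk (by omega)
  have := key i k (by omega) (by omega)
  positivity

lemma pt_inj {n i j : ℕ} (hn : 3 ≤ n) (hi : i < n) (hj : j < n) (h : pt n i = pt n j) : i = j := by
  by_contra hne
  wlog hlt : i < j generalizing i j
  · exact this hj hi h.symm (Ne.symm hne) (by omega)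
  -- pick a third index
  rcases Nat.lt_or_ge 0 i with h0 | h0
  · have := orient_pos (n := n) h0 hlt hj
    rw [h, orient_right] at this; exact lt_irrefl _ this
  · rcases Nat.lt_or_ge (j + 1) n with h1 | h1
    · have := orient_pos (n := n) hlt (Nat.lt_succ_self j) h1
      rw [h] at this
      simp [orient] at this
    · have := orient_pos (n := n) (i := i) (j := i + 1) (k := j) (by omega) (by omega) hj
      rw [h, orient_left] at this; exact lt_irrefl _ this

lemma hull_le {a b x : ℝ × ℝ} {s : Set (ℝ × ℝ)} (h : ∀ v ∈ s, orient a b v ≤ 0)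
    (hx : x ∈ convexHull ℝ s) : orient a b x ≤ 0 := by
  have hc : Convex ℝ {x | orient a b x ≤ 0} := by
    intro u hu v hv p q hp hq hpq
    simp only [Set.mem_ofPred_eq] at *
    have : orient a b (p • u + q • v) = p * orient a b u + q * orient a b v := by
      have hp' : p = 1 - q := by linarith
      subst hp'
      simp only [orient, Prod.fst_add, Prod.snd_add, Prod.smul_fst, Prod.smul_snd, smul_eq_mul]
      ring
    rw [this]; nlinarith
  exact convexHull_min h hc hx

lemma inside_mem {a b c x : ℝ × ℝ} (h1 : 0 < orient a b x) (h2 : 0 < orient b c x)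
    (h3 : 0 < orient c a x) : x ∈ convexHull ℝ ({a, b, c} : Set (ℝ × ℝ)) := by
  set S := orient a b x + orient b c x + orient c a x with hS
  have hpos : 0 < S := by positivity
  have hs : S = orient a b c := by rw [hS]; unfold orient; ring
  have := (convex_convexHull ℝ ({a, b, c} : Set (ℝ × ℝ))).sum_mem (t := Finset.univ)
    (w := ![orient b c x / S, orient c a x / S, orient a b x / S]) (z := ![a, b, c])
    (by intro i _; fin_cases i <;> simp <;> positivity)
    (by simp [Fin.sum_univ_three]; field_simp; rw [hS]; ring)
    (by intro i _; apply subset_convexHull; fin_cases i <;> simp)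
  convert this using 1
  simp only [Fin.sum_univ_three, Matrix.cons_val_zero, Matrix.cons_val_one, Matrix.cons_val]
  ext
  · simp only [Prod.fst_add, Prod.smul_fst, smul_eq_mul]
    field_simp
    rw [hs]; unfold orient; ring
  · simp only [Prod.snd_add, Prod.smul_snd, smul_eq_mul]
    field_simp
    rw [hs]; unfold orient; ring

lemma tri_subset (K : Geometry.SimplicialComplex ℝ (ℝ × ℝ)) {a b c x : ℝ × ℝ}
    {t : Finset (ℝ × ℝ)}
    (h1 : 0 < orient a b x) (h2 : 0 < orient b c x)
    (h3 : 0 < orient c a x) (hs : ({a, b, c} : Finset (ℝ × ℝ)) ∈ K.faces) (ht : t ∈ K.faces)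
    (hx : x ∈ convexHull ℝ (t : Set (ℝ × ℝ))) : ({a, b, c} : Finset (ℝ × ℝ)) ⊆ t := by
  have hx2 := K.inter_subset_convexHull hs ht ⟨by simpa using inside_mem h1 h2 h3, hx⟩
  have key : ∀ u v w : ℝ × ℝ, ({a, b, c} : Finset (ℝ × ℝ)) = {u, v, w} → 0 < orient u v x →
      w ∈ t := by
    intro u v w e hpos
    by_contra hw
    refine absurd (hull_le (a := u) (b := v) ?_ hx2) (not_le.2 hpos)
    rw [e]
    rintro y ⟨hy, hyt⟩
    simp only [Finset.coe_insert, Finset.coe_singleton, Set.mem_insert_iff,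
      Set.mem_singleton_iff] at hy
    rcases hy with rfl | rfl | rfl
    · rw [orient_left]
    · rw [orient_right]
    · exact absurd hyt hw
  intro y hy
  simp only [Finset.mem_insert, Finset.mem_singleton] at hy
  rcases hy with rfl | rfl | rfl
  · exact key _ _ _ (by ext; simp; tauto) h2
  · exact key _ _ _ (by ext; simp; tauto) h3
  · exact key _ _ _ rfl h1

lemma tri_eq (K : Geometry.SimplicialComplex ℝ (ℝ × ℝ)) {n i j k i' j' k' : ℕ} (hn : 3 ≤ n)
    {x : ℝ × ℝ} (hij : i < j) (hjk : j < k) (hk : k < n)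
    (hij' : i' < j') (hjk' : j' < k') (hk' : k' < n)
    (hs : ({pt n i, pt n j, pt n k} : Finset (ℝ × ℝ)) ∈ K.faces)
    (ht : ({pt n i', pt n j', pt n k'} : Finset (ℝ × ℝ)) ∈ K.faces)
    (h1 : 0 < orient (pt n i) (pt n j) x) (h2 : 0 < orient (pt n j) (pt n k) x)
    (h3 : 0 < orient (pt n k) (pt n i) x)
    (h1' : 0 < orient (pt n i') (pt n j') x) (h2' : 0 < orient (pt n j') (pt n k') x)
    (h3' : 0 < orient (pt n k') (pt n i') x) : i = i' ∧ j = j' ∧ k = k' := by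
  have A := tri_subset K h1 h2 h3 hs ht (by simpa using inside_mem h1' h2' h3')
  have inj : ∀ {a b}, a < n → b < n → pt n a = pt n b → a = b := fun ha hb => pt_inj hn ha hb
  have a1 := A (x := pt n i) (by simp)
  have a2 := A (x := pt n j) (by simp)
  have a3 := A (x := pt n k) (by simp)
  simp only [Finset.mem_insert, Finset.mem_singleton] at a1 a2 a3
  have b1 : i = i' ∨ i = j' ∨ i = k' := by
    rcases a1 with h | h | h <;> have := inj (by omega) (by omega) h <;> omega
  have b2 : j = i' ∨ j = j' ∨ j = k' := by
    rcases a2 with h | h | h <;> have := inj (by omega) (by omega) h <;> omega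
  have b3 : k = i' ∨ k = j' ∨ k = k' := by
    rcases a3 with h | h | h <;> have := inj (by omega) (by omega) h <;> omega
  omega

lemma ev_pos {a b M X : ℝ × ℝ} (h : 0 < orient a b M ∨ (orient a b M = 0 ∧ 0 < orient a b X)) :
    ∀ᶠ e : ℝ in 𝓝[>] 0, 0 < orient a b (AffineMap.lineMap M X e) := by
  simp only [orient_line]
  rcases h with h | ⟨h, h'⟩
  · apply Filter.Eventually.filter_mono nhdsWithin_le_nhds
    have hc : Continuous fun e : ℝ => (1 - e) * orient a b M + e * orient a b X := by fun_prop
    exact hc.continuousAt.eventually (lt_mem_nhds (by simpa using h))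
  · filter_upwards [self_mem_nhdsWithin] with e he
    rw [h]
    have : 0 < e := he
    simp; positivity

lemma ev_face (K : Geometry.SimplicialComplex ℝ (ℝ × ℝ)) (hfin : K.faces.Finite)
    {M X : ℝ × ℝ} (hMX : ∀ e : ℝ, 0 ≤ e → e ≤ 1 → AffineMap.lineMap M X e ∈ K.space) :
    ∃ s ∈ K.faces, ∃ e : ℝ, 0 < e ∧ e < 1 ∧ M ∈ convexHull ℝ (s : Set (ℝ × ℝ)) ∧
      AffineMap.lineMap M X e ∈ convexHull ℝ (s : Set (ℝ × ℝ)) := by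
  have h1 : ∀ᶠ y in 𝓝 M, ∀ s ∈ K.faces, M ∉ convexHull ℝ (s : Set (ℝ × ℝ)) →
      y ∉ convexHull ℝ (s : Set (ℝ × ℝ)) := by
    rw [Filter.eventually_all_finite hfin]
    intro s hs
    by_cases hM : M ∈ convexHull ℝ (s : Set (ℝ × ℝ))
    · simp [hM]
    · have hc : IsClosed (convexHull ℝ (s : Set (ℝ × ℝ))) :=
        (s.finite_toSet.isCompact_convexHull ℝ).isClosed
      filter_upwards [hc.isOpen_compl.mem_nhds hM] with y hy _ using hy
  have hc : Continuous fun e : ℝ => (AffineMap.lineMap M X e : ℝ × ℝ) :=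
    AffineMap.lineMap_continuous
  have h2 : ∀ᶠ e : ℝ in 𝓝 0, ∀ s ∈ K.faces, M ∉ convexHull ℝ (s : Set (ℝ × ℝ)) →
      (AffineMap.lineMap M X e : ℝ × ℝ) ∉ convexHull ℝ (s : Set (ℝ × ℝ)) := by
    have := hc.continuousAt (x := 0)
    unfold ContinuousAt at this
    beta_reduce at this
    rw [AffineMap.lineMap_apply_zero] at this
    exact this.eventually h1
  have h3 : ∀ᶠ e : ℝ in 𝓝[>] 0, e ∈ Set.Ioo (0 : ℝ) 1 := Ioo_mem_nhdsGT one_pos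
  obtain ⟨e, he, he'⟩ := ((h2.filter_mono nhdsWithin_le_nhds).and h3).exists
  obtain ⟨s, hs, hes⟩ := Geometry.SimplicialComplex.mem_space_iff.1 (hMX e he'.1.le he'.2.le)
  refine ⟨s, hs, e, he'.1, he'.2, ?_, hes⟩
  by_contra hM
  exact he s hs hM hes

section main
variable {n : ℕ} {K : Geometry.SimplicialComplex ℝ (ℝ × ℝ)}

lemma range_ngon (hn : 3 ≤ n) : Set.range (ngon n) = Set.image (pt n) (Set.Iio n) := by
  have : NeZero n := ⟨by omega⟩
  ext x
  constructor
  · rintro ⟨k, rfl⟩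
    exact ⟨k.val, ZMod.val_lt k, rfl⟩
  · rintro ⟨k, hk, rfl⟩
    refine ⟨(k : ZMod n), ?_⟩
    unfold ngon pt
    rw [ZMod.val_natCast_of_lt hk]

/-- Bundled hypotheses. -/
structure Good (n : ℕ) (K : Geometry.SimplicialComplex ℝ (ℝ × ℝ)) : Prop where
  hn : 3 ≤ n
  hv : K.vertices = Set.image (pt n) (Set.Iio n)
  hs : K.space = convexHull ℝ (Set.image (pt n) (Set.Iio n))

lemma Good.mem (G : Good n K) {s} (hs : s ∈ K.faces) {v} (hv : v ∈ s) : ∃ i < n, v = pt n i := by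
  have : v ∈ K.vertices := by
    rw [Geometry.SimplicialComplex.vertices_eq]
    exact Set.mem_biUnion hs hv
  rw [G.hv] at this
  obtain ⟨i, hi, rfl⟩ := this
  exact ⟨i, hi, rfl⟩

lemma Good.fin (G : Good n K) : K.faces.Finite := by
  refine (Finset.finite_toSet ((Finset.range n).image (pt n)).powerset).subset ?_
  intro s hs
  simp only [Finset.coe_powerset, Set.mem_preimage, Set.mem_powerset_iff, Finset.coe_subset]
  intro v hv
  obtain ⟨i, hi, rfl⟩ := G.mem hs hv
  exact Finset.mem_image_of_mem _ (Finset.mem_range.2 hi)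

lemma Good.pt_mem (G : Good n K) {i} (hi : i < n) : pt n i ∈ K.space := by
  rw [G.hs]; exact subset_convexHull _ _ ⟨i, hi, rfl⟩

lemma Good.conv (G : Good n K) : Convex ℝ K.space := by
  rw [G.hs]; exact convex_convexHull _ _

lemma Good.mid_mem (G : Good n K) {i j} (hi : i < n) (hj : j < n) :
    midpoint ℝ (pt n i) (pt n j) ∈ K.space :=
  G.conv.midpoint_mem (G.pt_mem hi) (G.pt_mem hj)

lemma Good.face (G : Good n K) {M X : ℝ × ℝ} (hM : M ∈ K.space) (hX : X ∈ K.space) :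
    ∃ s ∈ K.faces, ∃ e : ℝ, 0 < e ∧ e < 1 ∧ M ∈ convexHull ℝ (s : Set (ℝ × ℝ)) ∧
      AffineMap.lineMap M X e ∈ convexHull ℝ (s : Set (ℝ × ℝ)) :=
  ev_face K G.fin fun _ h0 h1 => G.conv.lineMap_mem hM hX ⟨h0, h1⟩

lemma Good.vmem (G : Good n K) {i} (hi : i < n) {s} (hs : s ∈ K.faces)
    (h : pt n i ∈ convexHull ℝ (s : Set (ℝ × ℝ))) : pt n i ∈ s := by
  refine (Geometry.SimplicialComplex.vertex_mem_convexHull_iff ?_ hs).1 h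
  rw [G.hv]; exact ⟨i, hi, rfl⟩

/-- Key sign argument: a face through `M` and a nearby point on the positive side of a line through
`M` has a vertex with positive sign. -/
lemma exists_vertex {a b M X : ℝ × ℝ} {e : ℝ} {s : Finset (ℝ × ℝ)} (he : 0 < e)
    (hM : orient a b M = 0) (hX : 0 < orient a b X)
    (h : AffineMap.lineMap M X e ∈ convexHull ℝ (s : Set (ℝ × ℝ))) :
    ∃ v ∈ s, 0 < orient a b v := by
  by_contra! hcon
  have := hull_le (fun v hv => hcon v hv) h
  rw [orient_line, hM] at this
  have : 0 < e * orient a b X := by positivity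
  linarith

/-- Points on the right side of the directed line from `i` to `j`. -/
lemma orient_np {i j m : ℕ} (h1 : i ≤ m) (h2 : m ≤ j) (hj : j < n) :
    orient (pt n i) (pt n j) (pt n m) ≤ 0 := by
  rcases h1.eq_or_lt with rfl | h1
  · rw [orient_left]
  rcases h2.eq_or_lt with rfl | h2
  · rw [orient_right]
  have := orient_pos h1 h2 hj
  unfold orient at *; linarith

lemma orient_nn {i j m : ℕ} (hij : i < j) (h : m ≤ i ∨ j ≤ m) (hj : j < n) (hm : m < n) :
    0 ≤ orient (pt n i) (pt n j) (pt n m) := by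
  rcases h with h | h
  · rcases h.eq_or_lt with rfl | h
    · rw [orient_left]
    have := orient_pos h hij hj
    unfold orient at *; linarith
  · rcases h.eq_or_lt with rfl | h
    · rw [orient_right]
    exact (orient_pos hij h hm).le

lemma Good.edge0 (G : Good n K) : ({pt n 0, pt n (n - 1)} : Finset (ℝ × ℝ)) ∈ K.faces := by
  have hn := G.hn
  obtain ⟨s, hs, e, he, he1, hM, hX⟩ := G.face (G.pt_mem (i := 0) (by omega))
    (G.pt_mem (i := n - 1) (by omega))
  have m0 := G.vmem (by omega) hs hM
  obtain ⟨v, hv, hpos⟩ := exists_vertex (a := pt n 0) (b := pt n (n - 2)) he (orient_left _ _)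
    (orient_pos (by omega) (by omega) (by omega)) hX
  obtain ⟨m, hm, rfl⟩ := G.mem hs hv
  have : m = n - 1 := by
    by_contra hne
    exact absurd (orient_np (n := n) (i := 0) (j := n - 2) (m := m) (by omega) (by omega)
      (by omega)) (not_le.2 hpos)
  subst this
  exact K.down_closed hs (by intro y; simp; rintro (rfl | rfl) <;> assumption) (by simp)

lemma Good.middle_ex (G : Good n K) {j : ℕ} (h0 : 0 < j) (h1 : j < n - 1) :
    ∃ i k, i < j ∧ j < k ∧ k < n ∧ ({pt n i, pt n j, pt n k} : Finset (ℝ × ℝ)) ∈ K.faces := by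
  have hn := G.hn
  obtain ⟨s, hs, e, he, he1, hM, hX⟩ := G.face (G.pt_mem (i := j) (by omega))
    (G.mid_mem (i := 0) (j := n - 1) (by omega) (by omega))
  have m0 := G.vmem (by omega) hs hM
  obtain ⟨v, hv, hpos⟩ := exists_vertex (a := pt n 0) (b := pt n j) he (orient_right _ _)
    (by
      rw [orient_mid, orient_left]
      have := orient_pos (n := n) h0 h1 (by omega)
      linarith) hX
  obtain ⟨k, hk, rfl⟩ := G.mem hs hv
  obtain ⟨w, hw, hpos'⟩ := exists_vertex (a := pt n j) (b := pt n (n - 1)) he (orient_left _ _)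
    (by
      rw [orient_mid, orient_right]
      have := orient_pos (n := n) h0 h1 (by omega)
      rw [← orient_rot] at this
      linarith) hX
  obtain ⟨i, hi, rfl⟩ := G.mem hs hw
  refine ⟨i, k, ?_, ?_, hk, ?_⟩
  · by_contra hne
    exact absurd (orient_np (n := n) (i := j) (j := n - 1) (m := i) (by omega) (by omega)
      (by omega)) (not_le.2 hpos')
  · by_contra hne
    exact absurd (orient_np (n := n) (i := 0) (j := j) (m := k) (by omega) (by omega)
      (by omega)) (not_le.2 hpos)
  · exact K.down_closed hs (by intro y; simp; rintro (rfl | rfl | rfl) <;> assumption) (by simp)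

lemma Good.middle_uniq (G : Good n K) {i j k i' k' : ℕ} (hij : i < j) (hjk : j < k) (hk : k < n)
    (hij' : i' < j) (hjk' : j < k') (hk' : k' < n)
    (hs : ({pt n i, pt n j, pt n k} : Finset (ℝ × ℝ)) ∈ K.faces)
    (ht : ({pt n i', pt n j, pt n k'} : Finset (ℝ × ℝ)) ∈ K.faces) : i = i' ∧ k = k' := by
  have key : ∀ i k, i < j → j < k → k < n → ∀ᶠ e : ℝ in 𝓝[>] 0,
      0 < orient (pt n i) (pt n j)
        (AffineMap.lineMap (pt n j) (midpoint ℝ (pt n 0) (pt n (n - 1))) e) ∧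
      0 < orient (pt n j) (pt n k)
        (AffineMap.lineMap (pt n j) (midpoint ℝ (pt n 0) (pt n (n - 1))) e) ∧
      0 < orient (pt n k) (pt n i)
        (AffineMap.lineMap (pt n j) (midpoint ℝ (pt n 0) (pt n (n - 1))) e) := by
    intro i k hij hjk hk
    refine (ev_pos (.inr ⟨orient_right _ _, ?_⟩)).and
      ((ev_pos (.inr ⟨orient_left _ _, ?_⟩)).and (ev_pos (.inl ?_)))
    · rw [orient_mid]
      have := orient_nn (n := n) (i := i) (j := j) (m := 0) hij (by omega) (by omega) (by omega)
      have := orient_pos (n := n) (i := i) (j := j) (k := n - 1) hij (by omega) (by omega)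
      linarith
    · rw [orient_mid]
      have := orient_nn (n := n) (i := j) (j := k) (m := n - 1) hjk (by omega) (by omega) (by omega)
      have := orient_pos (n := n) (i := 0) (j := j) (k := k) (by omega) (by omega) (by omega)
      rw [← orient_rot] at this
      linarith
    · rw [← orient_rot]; exact orient_pos hij hjk hk
  obtain ⟨e, ⟨a1, a2, a3⟩, ⟨b1, b2, b3⟩⟩ := ((key i k hij hjk hk).and (key i' k' hij' hjk' hk')).exists
  have := tri_eq K G.hn hij hjk hk hij' hjk' hk' hs ht a1 a2 a3 b1 b2 b3
  exact ⟨this.1, this.2.2⟩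

lemma Good.edge_ex (G : Good n K) {i j : ℕ} (hij : i + 2 ≤ j) (hj : j < n)
    (hs : ({pt n i, pt n j} : Finset (ℝ × ℝ)) ∈ K.faces) :
    ∃ k, i < k ∧ k < j ∧ ({pt n i, pt n k, pt n j} : Finset (ℝ × ℝ)) ∈ K.faces := by
  have hn := G.hn
  obtain ⟨s, hs', e, he, he1, hM, hX⟩ := G.face
    (G.mid_mem (i := i) (j := j) (by omega) (by omega)) (G.pt_mem (i := i + 1) (by omega))
  have hne : pt n i ≠ pt n j := fun h => by
    have := pt_inj hn (by omega) hj h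
    omega
  have hMe : midpoint ℝ (pt n i) (pt n j) ∈
      convexHull ℝ (({pt n i, pt n j} : Finset (ℝ × ℝ)) : Set (ℝ × ℝ)) :=
    (convex_convexHull ℝ _).midpoint_mem (subset_convexHull _ _ (by simp))
      (subset_convexHull _ _ (by simp))
  have hMi := K.inter_subset_convexHull hs hs' ⟨hMe, hM⟩
  have mi : pt n i ∈ s := by
    by_contra hcon
    have : midpoint ℝ (pt n i) (pt n j) ∈ convexHull ℝ ({pt n j} : Set (ℝ × ℝ)) := by
      refine convexHull_mono ?_ hMi
      rintro y ⟨hy, hys⟩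
      simp at hy
      rcases hy with rfl | rfl
      · exact absurd hys hcon
      · simp
    rw [convexHull_singleton, Set.mem_singleton_iff, midpoint_eq_right_iff] at this
    exact hne this
  have mj : pt n j ∈ s := by
    by_contra hcon
    have : midpoint ℝ (pt n i) (pt n j) ∈ convexHull ℝ ({pt n i} : Set (ℝ × ℝ)) := by
      refine convexHull_mono ?_ hMi
      rintro y ⟨hy, hys⟩
      simp at hy
      rcases hy with rfl | rfl
      · simp
      · exact absurd hys hcon
    rw [convexHull_singleton, Set.mem_singleton_iff, midpoint_eq_left_iff] at this
    exact hne this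
  obtain ⟨v, hv, hpos⟩ := exists_vertex (a := pt n j) (b := pt n i) he
    (by rw [orient_mid, orient_left, orient_right]; simp)
    (by rw [← orient_rot]; exact orient_pos (by omega) (by omega) hj) hX
  obtain ⟨k, hk, rfl⟩ := G.mem hs' hv
  have hkk : i < k ∧ k < j := by
    by_contra hcon
    have := orient_nn (n := n) (i := i) (j := j) (m := k) (by omega) (by omega) hj hk
    rw [orient_swap] at hpos
    linarith
  refine ⟨k, hkk.1, hkk.2, ?_⟩
  exact K.down_closed hs' (by intro y; simp; rintro (rfl | rfl | rfl) <;> assumption) (by simp)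

lemma Good.edge_uniq (G : Good n K) {i j k k' : ℕ} (hj : j < n)
    (h1 : i < k) (h2 : k < j) (h1' : i < k') (h2' : k' < j)
    (hs : ({pt n i, pt n k, pt n j} : Finset (ℝ × ℝ)) ∈ K.faces)
    (ht : ({pt n i, pt n k', pt n j} : Finset (ℝ × ℝ)) ∈ K.faces) : k = k' := by
  have key : ∀ k, i < k → k < j → ∀ᶠ e : ℝ in 𝓝[>] 0,
      0 < orient (pt n i) (pt n k)
        (AffineMap.lineMap (midpoint ℝ (pt n i) (pt n j)) (pt n (i + 1)) e) ∧
      0 < orient (pt n k) (pt n j)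
        (AffineMap.lineMap (midpoint ℝ (pt n i) (pt n j)) (pt n (i + 1)) e) ∧
      0 < orient (pt n j) (pt n i)
        (AffineMap.lineMap (midpoint ℝ (pt n i) (pt n j)) (pt n (i + 1)) e) := by
    intro k h1 h2
    have hp := orient_pos h1 h2 hj
    refine (ev_pos (.inl ?_)).and ((ev_pos (.inl ?_)).and (ev_pos (.inr ⟨?_, ?_⟩)))
    · rw [orient_mid, orient_left]; linarith
    · rw [orient_mid, orient_right, orient_rot]; linarith
    · rw [orient_mid, orient_left, orient_right]; simp
    · rw [← orient_rot]; exact orient_pos (by omega) (by omega) hj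
  obtain ⟨e, ⟨a1, a2, a3⟩, ⟨b1, b2, b3⟩⟩ := ((key k h1 h2).and (key k' h1' h2')).exists
  exact (tri_eq K G.hn h1 h2 hj h1' h2' hj hs ht a1 a2 a3 b1 b2 b3).2.1

/-- Ordered triangles. -/
def triSet (n : ℕ) (K : Geometry.SimplicialComplex ℝ (ℝ × ℝ)) : Set (ℕ × ℕ × ℕ) :=
  {p | p.1 < p.2.1 ∧ p.2.1 < p.2.2 ∧ p.2.2 < n ∧
    ({pt n p.1, pt n p.2.1, pt n p.2.2} : Finset (ℝ × ℝ)) ∈ K.faces}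

/-- Ordered long edges. -/
def edgeSet (n : ℕ) (K : Geometry.SimplicialComplex ℝ (ℝ × ℝ)) : Set (ℕ × ℕ) :=
  {p | p.1 + 2 ≤ p.2 ∧ p.2 < n ∧ ({pt n p.1, pt n p.2} : Finset (ℝ × ℝ)) ∈ K.faces}

lemma Good.card_tri (G : Good n K) : (triSet n K).ncard = n - 2 := by
  have : (triSet n K).ncard = (Set.Ioo 0 (n - 1)).ncard := by
    refine Set.ncard_congr (fun p _ => p.2.1) ?_ ?_ ?_
    · rintro ⟨i, j, k⟩ ⟨h1, h2, h3, -⟩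
      simp only [Set.mem_Ioo] at *; omega
    · rintro ⟨i, j, k⟩ ⟨i', j', k'⟩ ⟨h1, h2, h3, h⟩ ⟨h1', h2', h3', h'⟩ (rfl : j = j')
      obtain ⟨rfl, rfl⟩ := G.middle_uniq h1 h2 h3 h1' h2' h3' h h'
      rfl
    · rintro j ⟨h0, h1⟩
      obtain ⟨i, k, a, b, c, d⟩ := G.middle_ex h0 h1
      exact ⟨(i, j, k), ⟨a, b, c, d⟩, rfl⟩
  rw [this, Set.ncard_eq_toFinset_card']
  simp; omega

lemma Good.card_edge (G : Good n K) : (edgeSet n K).ncard = n - 2 := by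
  rw [← G.card_tri]
  symm
  refine Set.ncard_congr (fun p _ => (p.1, p.2.2)) ?_ ?_ ?_
  · rintro ⟨i, j, k⟩ ⟨h1, h2, h3, h⟩
    simp only at *
    refine ⟨by simp only; omega, h3, K.down_closed h ?_ (by simp)⟩
    intro y; simp; tauto
  · rintro ⟨i, j, k⟩ ⟨i', j', k'⟩ ⟨h1, h2, h3, h⟩ ⟨h1', h2', h3', h'⟩ heq
    simp only [Prod.mk.injEq] at heq
    obtain ⟨rfl, rfl⟩ := heq
    obtain rfl := G.edge_uniq h3 h1 h2 h1' h2' h h'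
    rfl
  · rintro ⟨i, k⟩ ⟨h0, h1, h⟩
    obtain ⟨j, a, b, c⟩ := G.edge_ex h0 h1 h
    exact ⟨(i, j, k), ⟨a, b, h1, c⟩, rfl⟩

lemma pt_mem_image (hn : 3 ≤ n) {s : Finset ℕ} (hs : ∀ a ∈ s, a < n) {a : ℕ} (ha : a < n) :
    pt n a ∈ s.image (pt n) ↔ a ∈ s := by
  constructor
  · intro h
    obtain ⟨b, hb, e⟩ := Finset.mem_image.1 h
    rwa [← pt_inj hn (hs b hb) ha e]
  · exact Finset.mem_image_of_mem _

lemma image_inj (hn : 3 ≤ n) {s t : Finset ℕ} (hs : ∀ a ∈ s, a < n) (ht : ∀ a ∈ t, a < n)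
    (h : s.image (pt n) = t.image (pt n)) : s = t := by
  ext a
  constructor
  · intro ha
    rw [← pt_mem_image hn ht (hs a ha), ← h, pt_mem_image hn hs (hs a ha)]; exact ha
  · intro ha
    rw [← pt_mem_image hn hs (ht a ha), h, pt_mem_image hn ht (ht a ha)]; exact ha

lemma Good.exists_image (G : Good n K) {s} (hs : s ∈ K.faces) :
    ∃ t : Finset ℕ, (∀ a ∈ t, a < n) ∧ t.image (pt n) = s ∧ t.card = s.card := by
  refine ⟨(Finset.range n).filter (fun a => pt n a ∈ s), ?_, ?_, ?_⟩
  · intro a ha; simp at ha; exact ha.1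
  · ext v
    simp only [Finset.mem_image, Finset.mem_filter, Finset.mem_range]
    constructor
    · rintro ⟨a, ⟨-, h⟩, rfl⟩; exact h
    · intro hv
      obtain ⟨i, hi, rfl⟩ := G.mem hs hv
      exact ⟨i, ⟨hi, hv⟩, rfl⟩
  · refine Finset.card_bij (fun a _ => pt n a) ?_ ?_ ?_
    · intro a ha; simp at ha; exact ha.2
    · intro a ha b hb h
      simp at ha hb
      exact pt_inj G.hn ha.1 hb.1 h
    · intro v hv
      obtain ⟨i, hi, rfl⟩ := G.mem hs hv
      exact ⟨i, by simp [hi, hv], rfl⟩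

lemma Good.tri (G : Good n K) : {s ∈ K.faces | s.card = 3}.ncard = n - 2 := by
  rw [← G.card_tri]
  symm
  have hn := G.hn
  refine Set.ncard_congr (fun p _ => {pt n p.1, pt n p.2.1, pt n p.2.2}) ?_ ?_ ?_
  · rintro ⟨i, j, k⟩ ⟨h1, h2, h3, h⟩
    refine ⟨h, ?_⟩
    simp only at *
    rw [Finset.card_eq_three]
    refine ⟨_, _, _, ?_, ?_, ?_, rfl⟩ <;>
    · intro h
      have := pt_inj hn (by omega) (by omega) h
      omega
  · rintro ⟨i, j, k⟩ ⟨i', j', k'⟩ ⟨h1, h2, h3, h⟩ ⟨h1', h2', h3', h'⟩ heq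
    simp only at *
    have := image_inj hn (s := {i, j, k}) (t := {i', j', k'}) (by simp; omega) (by simp; omega)
      (by simpa [Finset.image_insert] using heq)
    simp only [Finset.ext_iff, Finset.mem_insert, Finset.mem_singleton] at this
    have e1 := this i
    have e2 := this j
    have e3 := this k
    simp only [Prod.mk.injEq]
    omega
  · rintro s ⟨hs, hc⟩
    obtain ⟨t, ht, rfl, hcard⟩ := G.exists_image hs
    rw [hc] at hcard
    obtain ⟨i, j, k, h1, h2, rfl⟩ : ∃ i j k, i < j ∧ j < k ∧ t = {i, j, k} := by
      obtain ⟨x, y, z, hxy, hxz, hyz, rfl⟩ := Finset.card_eq_three.1 hcard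
      have : (x < y ∧ y < z) ∨ (x < z ∧ z < y) ∨ (y < x ∧ x < z) ∨ (y < z ∧ z < x) ∨
        (z < x ∧ x < y) ∨ (z < y ∧ y < x) := by omega
      rcases this with h | h | h | h | h | h <;>
        exact ⟨_, _, _, h.1, h.2, by ext; simp <;> tauto⟩
    have e : Finset.image (pt n) {i, j, k} = {pt n i, pt n j, pt n k} := by
      simp [Finset.image_insert]
    rw [e] at hs
    exact ⟨(i, j, k), ⟨h1, h2, ht k (by simp), hs⟩, e.symm⟩

lemma Good.diag (G : Good n K) : {s ∈ K.faces | s.card = 2 ∧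
      ∀ i : ZMod n, s ≠ ({ngon n i, ngon n (i + 1)} : Finset (ℝ × ℝ))}.ncard = n - 3 := by
  have hn := G.hn
  have : NeZero n := ⟨by omega⟩
  have : Fact (1 < n) := ⟨by omega⟩
  have hng : ∀ i : ZMod n, ngon n i = pt n i.val := fun _ => rfl
  have h0 : ((0 : ℕ), n - 1) ∈ edgeSet n K := ⟨by simp only; omega, by simp only; omega, G.edge0⟩
  have hsub : (edgeSet n K \ {(0, n - 1)}).ncard = n - 3 := by
    rw [Set.ncard_sdiff_singleton_of_mem h0, G.card_edge]; omega
  rw [← hsub]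
  symm
  refine Set.ncard_congr (fun p _ => {pt n p.1, pt n p.2}) ?_ ?_ ?_
  · rintro ⟨i, j⟩ ⟨⟨h1, h2, h⟩, hne⟩
    simp only [Set.mem_singleton_iff, Prod.mk.injEq] at *
    refine ⟨h, ?_, ?_⟩
    · rw [Finset.card_eq_two]
      refine ⟨_, _, ?_, rfl⟩
      intro h
      have := pt_inj hn (by omega) (by omega) h
      omega
    · intro a heq
      rw [hng, hng] at heq
      have hv := ZMod.val_lt a
      have hv' := ZMod.val_lt (a + 1)
      have := image_inj hn (s := {i, j}) (t := {a.val, (a + 1).val}) (by simp; omega)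
        (by simp; omega) (by simpa [Finset.image_insert] using heq)
      simp only [Finset.ext_iff, Finset.mem_insert, Finset.mem_singleton] at this
      have e1 := this i
      have e2 := this j
      have e3 := ZMod.val_add a 1
      rw [ZMod.val_one] at e3
      rcases Nat.lt_or_ge (a.val + 1) n with h | h
      · rw [Nat.mod_eq_of_lt h] at e3; omega
      · have : a.val + 1 = n := by omega
        rw [this, Nat.mod_self] at e3; omega
  · rintro ⟨i, j⟩ ⟨i', j'⟩ ⟨⟨h1, h2, h⟩, -⟩ ⟨⟨h1', h2', h'⟩, -⟩ heq
    simp only at *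
    have := image_inj hn (s := {i, j}) (t := {i', j'}) (by simp; omega) (by simp; omega)
      (by simpa [Finset.image_insert] using heq)
    simp only [Finset.ext_iff, Finset.mem_insert, Finset.mem_singleton] at this
    have e1 := this i
    have e2 := this j
    simp only [Prod.mk.injEq]
    omega
  · rintro s ⟨hs, hc, hnot⟩
    obtain ⟨t, ht, rfl, hcard⟩ := G.exists_image hs
    rw [hc] at hcard
    obtain ⟨i, j, h1, rfl⟩ : ∃ i j, i < j ∧ t = {i, j} := by
      obtain ⟨x, y, hxy, rfl⟩ := Finset.card_eq_two.1 hcard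
      rcases lt_or_gt_of_ne hxy with h | h
      · exact ⟨_, _, h, rfl⟩
      · exact ⟨_, _, h, by ext; simp; tauto⟩
    have e : Finset.image (pt n) {i, j} = {pt n i, pt n j} := by
      simp [Finset.image_insert]
    have hj := ht j (by simp)
    rw [e] at hs hnot
    refine ⟨(i, j), ⟨⟨?_, hj, hs⟩, ?_⟩, e.symm⟩
    · by_contra hcon
      simp only at hcon
      obtain rfl : j = i + 1 := by omega
      apply hnot (i : ZMod n)
      rw [hng, hng, ZMod.val_natCast_of_lt (by omega), ← Nat.cast_succ,
        ZMod.val_natCast_of_lt hj]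
    · simp only [Set.mem_singleton_iff, Prod.mk.injEq]
      rintro ⟨rfl, rfl⟩
      apply hnot ((n - 1 : ℕ) : ZMod n)
      rw [hng, hng, ZMod.val_natCast_of_lt hj, ← Nat.cast_succ,
        show (n - 1).succ = n by omega, ZMod.natCast_self, ZMod.val_zero, Finset.pair_comm]

end main

theorem stmt_11 (n : ℕ) (hn : 3 ≤ n) (K : Geometry.SimplicialComplex ℝ (ℝ × ℝ))
    (hvert : K.vertices = Set.range (ngon n))
    (hspace : K.space = convexHull ℝ (Set.range (ngon n))) :
    {s ∈ K.faces | s.card = 3}.ncard = n - 2 ∧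
    {s ∈ K.faces | s.card = 2 ∧
      ∀ i : ZMod n, s ≠ ({ngon n i, ngon n (i + 1)} : Finset (ℝ × ℝ))}.ncard = n - 3 := by
  rw [range_ngon hn] at hvert hspace
  have G : Good n K := ⟨hn, hvert, hspace⟩
  exact ⟨G.tri, G.diag⟩
end
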